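/- arXiv:2405.14248 — 4 statements merged into one kernel-verified Lean document; each statement's English description precedes it below -/
import Mathlib

section
/- The integral of x·√(x²+1)·sin(4x·√(x²+1))·e^{-3x²} over x from 0 to ∞ equals 51√π/(500e). -/
open Real MeasureTheory

open Filter Topology in
theorem integral_add_mul_I_eq_integral_of_norm_le {f : ℂ → ℂ} (hf : Differentiable ℂ f) {φ : ℝ}
    (hφ : 0 ≤ φ) {b : ℝ → ℝ} (hb : Integrable b) (hb_top : Tendsto b atTop (𝓝 0))
    (hb_bot : Tendsto b atBot (𝓝 0))
    (hfb : ∀ t : ℝ, ∀ y ∈ Set.Icc 0 φ, ‖f (t + y * Complex.I)‖ ≤ b t) :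
    ∫ t : ℝ, f (t + φ * Complex.I) = ∫ t : ℝ, f t := by
  have hint : ∀ y ∈ Set.Icc 0 φ, Integrable fun t : ℝ ↦ f (t + y * Complex.I) := fun y hy ↦
    hb.mono' (by have := hf.continuous; fun_prop) (.of_forall fun t ↦ hfb t y hy)
  have hside : ∀ l : Filter ℝ, Tendsto b l (𝓝 0) →
      Tendsto (fun T : ℝ ↦ ∫ y : ℝ in (0 : ℝ)..φ, f (T + y * Complex.I)) l (𝓝 0) := by
    intro l hl
    refine squeeze_zero_norm (a := fun T ↦ b T * |φ - 0|) (fun T ↦ ?_) (by simpa using hl.mul_const _)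
    refine intervalIntegral.norm_integral_le_of_norm_le_const fun y hy ↦ hfb T y ?_
    rw [Set.uIoc_of_le hφ] at hy
    exact Set.Ioc_subset_Icc_self hy
  have hline : ∀ y ∈ Set.Icc 0 φ, Tendsto (fun T : ℝ ↦ ∫ t : ℝ in (-T)..T, f (t + y * Complex.I))
      atTop (𝓝 (∫ t : ℝ, f (t + y * Complex.I))) := fun y hy ↦
    intervalIntegral_tendsto_integral (hint y hy) tendsto_neg_atTop_atBot tendsto_id
  have hlim := (((hline 0 ⟨le_rfl, hφ⟩).sub (hline φ ⟨hφ, le_rfl⟩)).add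
    ((hside atTop hb_top).const_smul Complex.I)).sub
    (((hside atBot hb_bot).comp tendsto_neg_atTop_atBot).const_smul Complex.I)
  have hzero := tendsto_nhds_unique hlim <| tendsto_const_nhds.congr fun T ↦ by
    have := Complex.integral_boundary_rect_eq_zero_of_differentiableOn f (⟨-T, 0⟩ : ℂ) ⟨T, φ⟩
      hf.differentiableOn
    simpa using this.symm
  simp only [smul_zero, add_zero, sub_zero, Complex.ofReal_zero, zero_mul] at hzero
  exact (sub_eq_zero.mp hzero).symm

theorem integral_comp_sinh_mul_cosh (g : ℝ → ℝ) :
    ∫ t, Real.cosh t * g (Real.sinh t) = ∫ x, g x := by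
  have h := integral_image_eq_integral_abs_deriv_smul (s := Set.univ) (f := Real.sinh)
    (f' := Real.cosh) .univ (fun x _ ↦ (Real.hasDerivAt_sinh x).hasDerivWithinAt)
    Real.sinh_injective.injOn g
  rw [Set.image_univ, Real.sinh_surjective.range_eq] at h
  simpa [abs_of_pos (Real.cosh_pos _)] using h.symm

theorem integral_sq_mul_gaussian {b : ℝ} (hb : 0 < b) :
    ∫ x : ℝ, x ^ 2 * Real.exp (-b * x ^ 2) = √(π / b) / (2 * b) := by
  have h₁ : ∫ x : ℝ, x ^ 2 * Real.exp (-b * x ^ 2) =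
      2 * ∫ x in Set.Ioi (0 : ℝ), x ^ 2 * Real.exp (-b * x ^ 2) := by
    rw [← integral_comp_abs]
    simp
  have h₂ := integral_rpow_mul_exp_neg_mul_rpow (p := 2) (q := 2) (b := b)
    (by norm_num) (by norm_num) hb
  have h₃ : Real.Gamma (3 / 2) = √π / 2 := by
    rw [show (3 / 2 : ℝ) = 1 / 2 + 1 by norm_num, Real.Gamma_add_one (by norm_num),
      Real.Gamma_one_half_eq]
    ring
  have h₄ : b ^ (-(3 / 2) : ℝ) = 1 / (√b * b) := by
    rw [Real.rpow_neg hb.le, show (3 / 2 : ℝ) = 1 / 2 + 1 by norm_num, Real.rpow_add hb,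
      ← Real.sqrt_eq_rpow, Real.rpow_one, one_div]
  norm_num [h₃, h₄] at h₂
  rw [h₁]
  simp only [neg_mul]
  rw [h₂, Real.sqrt_div Real.pi_pos.le]
  have := Real.sqrt_pos.mpr hb
  field_simp

/-- In the variable `x = sinh t`, the imaginary part of `kernel t dt` is the integrand
`x √(x² + 1) sin (4 x √(x² + 1)) exp (-3 x²) dx`. -/
noncomputable def kernel (z : ℂ) : ℂ :=
  Complex.sinh z * Complex.cosh z ^ 2 *
    Complex.exp (4 * Complex.I * (Complex.sinh z * Complex.cosh z) - 3 * Complex.sinh z ^ 2)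

theorem differentiable_kernel : Differentiable ℂ kernel := by
  have h₁ := Complex.differentiable_sinh
  have h₂ := Complex.differentiable_cosh
  unfold kernel
  fun_prop

theorem complex_sinh_add_mul_I (t y : ℝ) : Complex.sinh (t + y * Complex.I) =
    ⟨Real.sinh t * Real.cos y, Real.cosh t * Real.sin y⟩ := by
  rw [Complex.sinh_add, Complex.cosh_mul_I, Complex.sinh_mul_I]
  rw [← Complex.ofReal_sinh, ← Complex.ofReal_cosh, ← Complex.ofReal_sin, ← Complex.ofReal_cos]
  apply Complex.ext <;> simp [-Complex.ofReal_sinh, -Complex.ofReal_cosh, -Complex.ofReal_sin,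
    -Complex.ofReal_cos]

theorem complex_cosh_add_mul_I (t y : ℝ) : Complex.cosh (t + y * Complex.I) =
    ⟨Real.cosh t * Real.cos y, Real.sinh t * Real.sin y⟩ := by
  rw [Complex.cosh_add, Complex.cosh_mul_I, Complex.sinh_mul_I]
  rw [← Complex.ofReal_sinh, ← Complex.ofReal_cosh, ← Complex.ofReal_sin, ← Complex.ofReal_cos]
  apply Complex.ext <;> simp [-Complex.ofReal_sinh, -Complex.ofReal_cosh, -Complex.ofReal_sin,
    -Complex.ofReal_cos]

theorem norm_kernel_le (t : ℝ) {y : ℝ} (hs : 0 ≤ Real.sin y) (hsc : Real.sin y ≤ Real.cos y) :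
    ‖kernel (t + y * Complex.I)‖ ≤ Real.exp (-1 * t ^ 2) := by
  have hcs := Real.sin_sq_add_cos_sq y
  have hw := Real.cosh_sq t
  have hw₁ := Real.one_le_cosh t
  have ht : t ^ 2 ≤ Real.sinh t ^ 2 := by
    rw [sq_le_sq, Real.abs_sinh]
    exact Real.self_le_sinh_iff.mpr (abs_nonneg t)
  rw [kernel, complex_sinh_add_mul_I, complex_cosh_add_mul_I, norm_mul, norm_mul, norm_pow,
    Complex.norm_exp]
  generalize Real.sin y = s at *
  generalize Real.cos y = c at *
  generalize Real.cosh t = w at *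
  generalize Real.sinh t = u at *
  have hS : ‖(⟨u * c, w * s⟩ : ℂ)‖ ≤ w := by
    refine (sq_le_sq₀ (norm_nonneg _) (by linarith)).mp ?_
    rw [Complex.sq_norm, Complex.normSq_apply]
    nlinarith [sq_nonneg c]
  have hC : ‖(⟨w * c, u * s⟩ : ℂ)‖ ≤ w := by
    refine (sq_le_sq₀ (norm_nonneg _) (by linarith)).mp ?_
    rw [Complex.sq_norm, Complex.normSq_apply]
    nlinarith [sq_nonneg s]
  have hre : (4 * Complex.I * ((⟨u * c, w * s⟩ : ℂ) * (⟨w * c, u * s⟩ : ℂ)) -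
      3 * (⟨u * c, w * s⟩ : ℂ) ^ 2).re ≤ -3 * u ^ 2 := by
    have : (4 * Complex.I * ((⟨u * c, w * s⟩ : ℂ) * (⟨w * c, u * s⟩ : ℂ)) -
      3 * (⟨u * c, w * s⟩ : ℂ) ^ 2).re =
        -4 * (s * c * (u ^ 2 + w ^ 2)) - 3 * (u ^ 2 * c ^ 2 - w ^ 2 * s ^ 2) := by
      simp [pow_two]
      ring
    rw [this, hw]
    have h₁ : 0 ≤ s * (c - s) := mul_nonneg hs (by linarith)
    have h₂ : c ^ 2 = 1 - s ^ 2 := by linarith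
    rw [h₂]
    nlinarith [mul_nonneg (sq_nonneg u) h₁, mul_nonneg (sq_nonneg u) (sq_nonneg s), sq_nonneg s]
  have hpoly : w * w ^ 2 ≤ Real.exp (2 * u ^ 2) := by
    calc w * w ^ 2 ≤ (u ^ 2 + 1) ^ 2 := by rw [← hw]; nlinarith [pow_pos (by linarith : 0 < w) 3]
      _ ≤ Real.exp (u ^ 2) ^ 2 := by gcongr; exact Real.add_one_le_exp _
      _ = Real.exp (2 * u ^ 2) := by rw [← Real.exp_nat_mul]; norm_num
  calc _ ≤ w * w ^ 2 * Real.exp (-3 * u ^ 2) := by gcongr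
    _ ≤ Real.exp (2 * u ^ 2) * Real.exp (-3 * u ^ 2) := by gcongr
    _ = Real.exp (-1 * u ^ 2) := by rw [← Real.exp_add]; ring_nf
    _ ≤ _ := Real.exp_le_exp.mpr (by linarith)

theorem kernel_im_ofReal (t : ℝ) : (kernel t).im = Real.cosh t *
    (Real.sinh t * √(Real.sinh t ^ 2 + 1) * Real.sin (4 * Real.sinh t * √(Real.sinh t ^ 2 + 1)) *
      Real.exp (-3 * Real.sinh t ^ 2)) := by
  have hw : √(Real.sinh t ^ 2 + 1) = Real.cosh t := by
    rw [← Real.cosh_sq, Real.sqrt_sq (Real.cosh_pos t).le]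
  rw [hw, kernel, ← Complex.ofReal_sinh, ← Complex.ofReal_cosh]
  generalize Real.cosh t = w
  generalize Real.sinh t = u
  rw [show (u : ℂ) * (w : ℂ) ^ 2 = ((u * w ^ 2 : ℝ) : ℂ) by push_cast; ring,
    show 4 * Complex.I * ((u : ℂ) * w) - 3 * (u : ℂ) ^ 2 = ⟨-3 * u ^ 2, 4 * u * w⟩ by
      apply Complex.ext <;> simp [pow_two, mul_assoc],
    Complex.im_ofReal_mul, Complex.exp_im]
  ring

theorem kernel_im_add_arctan (t : ℝ) : (kernel (t + Real.arctan (1 / 2) * Complex.I)).im =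
    Real.cosh t * ((11 * Real.sinh t ^ 2 + 4) * Real.exp (-5 * Real.sinh t ^ 2) *
      (Real.exp (-1) / (5 * √5))) := by
  have hw := Real.cosh_sq t
  have h₅ : √5 ^ 2 = (5 : ℝ) := Real.sq_sqrt (by norm_num)
  have h₅' : √5 ≠ 0 := by positivity
  have hsqrt : √(1 + (1 / 2) ^ 2) = √5 / 2 := by
    rw [show (1 + (1 / 2) ^ 2 : ℝ) = 5 / 2 ^ 2 by norm_num, Real.sqrt_div' _ (by positivity),
      Real.sqrt_sq (by norm_num)]
  have hsin : Real.sin (Real.arctan (1 / 2)) = 1 / √5 := by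
    rw [Real.sin_arctan, hsqrt]
    field_simp
  have hcos : Real.cos (Real.arctan (1 / 2)) = 2 / √5 := by
    rw [Real.cos_arctan, hsqrt]
    field_simp
  rw [kernel, complex_sinh_add_mul_I, complex_cosh_add_mul_I, hsin, hcos]
  generalize Real.cosh t = w at *
  generalize Real.sinh t = u at *
  have hexp : 4 * Complex.I * ((⟨u * (2 / √5), w * (1 / √5)⟩ : ℂ) *
      (⟨w * (2 / √5), u * (1 / √5)⟩ : ℂ)) - 3 * (⟨u * (2 / √5), w * (1 / √5)⟩ : ℂ) ^ 2 =
      ((-5 * u ^ 2 + -1 : ℝ) : ℂ) := by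
    apply Complex.ext
    · simp [pow_two]
      field_simp
      rw [h₅, hw]
      ring
    · simp [pow_two]
      field_simp
      ring
  rw [hexp, ← Complex.ofReal_exp, Complex.im_mul_ofReal, Real.exp_add]
  have him : ((⟨u * (2 / √5), w * (1 / √5)⟩ : ℂ) * (⟨w * (2 / √5), u * (1 / √5)⟩ : ℂ) ^ 2).im =
      w * (11 * u ^ 2 + 4) / (5 * √5) := by
    simp [pow_two]
    field_simp
    rw [h₅]
    linear_combination 20 * w * hw
  rw [him]
  ring

theorem stmt3 :
    ∫ x in Set.Ioi (0:ℝ), x * Real.sqrt (x^2 + 1) * Real.sin (4 * x * Real.sqrt (x^2 + 1)) * Real.exp (-3 * x^2)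
      = 51 * Real.sqrt π / (500 * Real.exp 1) := by
  have hφ₀ : 0 ≤ Real.arctan (1 / 2) := by rw [Real.arctan_nonneg]; norm_num
  have hφ₁ : Real.arctan (1 / 2) ≤ π / 4 := by
    rw [← Real.arctan_one]
    exact Real.arctan_mono (by norm_num)
  have hbound : ∀ t : ℝ, ∀ y ∈ Set.Icc 0 (Real.arctan (1 / 2)),
      ‖kernel (t + y * Complex.I)‖ ≤ Real.exp (-1 * t ^ 2) := by
    rintro t y ⟨hy₀, hy₁⟩
    have hπ := Real.pi_pos
    refine norm_kernel_le t (Real.sin_nonneg_of_nonneg_of_le_pi hy₀ (by linarith)) ?_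
    rw [← Real.cos_pi_div_two_sub]
    exact Real.cos_le_cos_of_nonneg_of_le_pi hy₀ (by linarith) (by linarith)
  have hgauss : Integrable fun t : ℝ ↦ Real.exp (-1 * t ^ 2) := integrable_exp_neg_mul_sq one_pos
  have hint : ∀ y ∈ Set.Icc 0 (Real.arctan (1 / 2)),
      Integrable fun t : ℝ ↦ kernel (t + y * Complex.I) := fun y hy ↦
    hgauss.mono' (by have := differentiable_kernel.continuous; fun_prop)
      (.of_forall fun t ↦ hbound t y hy)
  have htop : Filter.Tendsto (fun t : ℝ ↦ Real.exp (-1 * t ^ 2)) Filter.atTop (nhds 0) := by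
    simp
  have hbot : Filter.Tendsto (fun t : ℝ ↦ Real.exp (-1 * t ^ 2)) Filter.atBot (nhds 0) := by
    simpa [Function.comp_def] using htop.comp Filter.tendsto_neg_atBot_atTop
  have hshift := congrArg Complex.im <| integral_add_mul_I_eq_integral_of_norm_le
    differentiable_kernel hφ₀ hgauss htop hbot hbound
  have hint₀ : Integrable fun t : ℝ ↦ kernel t := by simpa using hint 0 ⟨le_rfl, hφ₀⟩
  have him := integral_im (hint _ ⟨hφ₀, le_rfl⟩)
  have him₀ := integral_im hint₀
  simp only [RCLike.im_to_complex] at him him₀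
  rw [← him, ← him₀] at hshift
  simp only [kernel_im_ofReal, kernel_im_add_arctan] at hshift
  rw [integral_comp_sinh_mul_cosh (fun x ↦ (11 * x ^ 2 + 4) * Real.exp (-5 * x ^ 2) *
      (Real.exp (-1) / (5 * √5))),
    integral_comp_sinh_mul_cosh (fun x ↦ x * √(x ^ 2 + 1) * Real.sin (4 * x * √(x ^ 2 + 1)) *
      Real.exp (-3 * x ^ 2)), integral_mul_const] at hshift
  have hgauss₅ : Integrable fun x : ℝ ↦ Real.exp (-5 * x ^ 2) :=
    integrable_exp_neg_mul_sq (by norm_num)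
  have hsq₅ : Integrable fun x : ℝ ↦ x ^ 2 * Real.exp (-5 * x ^ 2) := by
    simpa using integrable_rpow_mul_exp_neg_mul_sq (b := 5) (by norm_num) (s := 2) (by norm_num)
  have hmoment : ∫ x : ℝ, (11 * x ^ 2 + 4) * Real.exp (-5 * x ^ 2) = 51 / 10 * √(π / 5) := by
    simp only [add_mul, mul_assoc]
    rw [integral_add (hsq₅.const_mul 11) (hgauss₅.const_mul 4), integral_const_mul,
      integral_const_mul, integral_sq_mul_gaussian (by norm_num), integral_gaussian]
    ring
  have heven : ∫ x : ℝ, x * √(x ^ 2 + 1) * Real.sin (4 * x * √(x ^ 2 + 1)) *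
      Real.exp (-3 * x ^ 2) = 2 * ∫ x in Set.Ioi (0 : ℝ), x * √(x ^ 2 + 1) *
        Real.sin (4 * x * √(x ^ 2 + 1)) * Real.exp (-3 * x ^ 2) := by
    rw [← integral_comp_abs]
    refine integral_congr_ae (.of_forall fun x ↦ ?_)
    rcases abs_choice x with h | h <;> simp [h]
  rw [hmoment, heven, Real.sqrt_div Real.pi_pos.le, Real.exp_neg] at hshift
  have h₅ : √5 ^ 2 = (5 : ℝ) := Real.sq_sqrt (by norm_num)
  rw [← mul_right_inj' (two_ne_zero (α := ℝ)), ← hshift]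
  field_simp
  rw [h₅]
  norm_num
end

section
/- The integral over x from 0 to ∞ of (√(√(x²+9)+3)/√(x²+9))·cos(12x)·e^{-5√(x²+9)} equals 3√π/(13·e^{39}). -/
open Real MeasureTheory

theorem Real.cosh_eq_one_add_two_mul_sinh_half_sq (t : ℝ) :
    cosh t = 1 + 2 * sinh (t / 2) ^ 2 := by
  have h := cosh_two_mul (t / 2)
  rw [mul_div_cancel₀ t two_ne_zero, cosh_sq] at h
  linarith

theorem Real.one_add_sq_div_two_le_cosh (t : ℝ) : 1 + t ^ 2 / 2 ≤ cosh t := by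
  have hcosh := cosh_eq_one_add_two_mul_sinh_half_sq t
  have hsinh : (t / 2) ^ 2 ≤ sinh (t / 2) ^ 2 := by
    rw [sq_le_sq, abs_sinh]
    exact self_le_sinh_iff.2 (abs_nonneg _)
  linarith

theorem Complex.norm_sinh_le_cosh_re (z : ℂ) : ‖Complex.sinh z‖ ≤ Real.cosh z.re := by
  rw [Complex.sinh, norm_div, Real.cosh_eq]
  have h := norm_sub_le (Complex.exp z) (Complex.exp (-z))
  rw [Complex.norm_exp, Complex.norm_exp, Complex.neg_re] at h
  simpa using div_le_div_of_nonneg_right h zero_le_two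

theorem integrable_exp_half_sub_mul_cosh {a : ℝ} (ha : 0 < a) :
    Integrable fun t : ℝ => exp (t / 2 - a * cosh t) := by
  refine ((integrable_exp_neg_mul_sq (b := a / 4) (by positivity)).const_mul
    (exp (1 / (4 * a)))).mono' (by fun_prop) (.of_forall fun t => ?_)
  rw [norm_of_nonneg (exp_pos _).le, ← exp_add, exp_le_exp]
  have h₁ := mul_le_mul_of_nonneg_left (one_add_sq_div_two_le_cosh t) ha.le
  have h₂ : 1 / (4 * a) + a / 4 * t ^ 2 - t / 2 = (a * t - 1) ^ 2 / (4 * a) := by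
    field_simp
    ring
  have h₃ : 0 ≤ (a * t - 1) ^ 2 / (4 * a) := by positivity
  linarith

theorem integrable_cosh_mul_exp_half_sub_mul_cosh {a : ℝ} (ha : 0 < a) :
    Integrable fun t : ℝ => cosh t * exp (t / 2 - a * cosh t) := by
  refine ((integrable_exp_half_sub_mul_cosh (half_pos ha)).const_mul (2 / a)).mono'
    (by fun_prop) (.of_forall fun t => ?_)
  have hc := cosh_pos t
  rw [norm_of_nonneg (by positivity)]
  have h₁ : cosh t ≤ 2 / a * exp (a / 2 * cosh t) := by
    have h := add_one_le_exp (a / 2 * cosh t)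
    calc cosh t = 2 / a * (a / 2 * cosh t) := by field_simp
      _ ≤ _ := by gcongr; linarith
  calc cosh t * exp (t / 2 - a * cosh t)
      ≤ 2 / a * exp (a / 2 * cosh t) * exp (t / 2 - a * cosh t) := by gcongr
    _ = _ := by rw [mul_assoc, ← exp_add]; ring_nf

/-- For `r > 0`, the integral of this function over `ℝ` is `2 * K_{1/2}(r)`. -/
noncomputable def besselKernel (r : ℝ) (z : ℂ) : ℂ :=
  Complex.exp (z / 2 - r * Complex.cosh z)

theorem hasDerivAt_besselKernel (r : ℝ) (z : ℂ) :
    HasDerivAt (besselKernel r) (besselKernel r z * (1 / 2 - r * Complex.sinh z)) z :=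
  (((hasDerivAt_id z).div_const 2).sub ((Complex.hasDerivAt_cosh z).const_mul (r : ℂ))).cexp

theorem continuous_besselKernel (r : ℝ) : Continuous (besselKernel r) := by
  unfold besselKernel
  fun_prop

theorem besselKernel_add_mul_I (r t φ : ℝ) : besselKernel r (t + φ * Complex.I) =
    Complex.exp ((t / 2 - r * cos φ * cosh t : ℝ) +
      (φ / 2 - r * sin φ * sinh t : ℝ) * Complex.I) := by
  rw [besselKernel, Complex.cosh_add, Complex.cosh_mul_I, Complex.sinh_mul_I]
  push_cast
  ring_nf

theorem norm_besselKernel (r t φ : ℝ) :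
    ‖besselKernel r (t + φ * Complex.I)‖ = exp (t / 2 - r * cos φ * cosh t) := by
  rw [besselKernel_add_mul_I, Complex.norm_exp, Complex.add_re, Complex.re_ofReal_mul,
    Complex.I_re, mul_zero, add_zero, Complex.ofReal_re]

theorem integrable_besselKernel {r φ : ℝ} (h : 0 < r * cos φ) :
    Integrable fun t : ℝ => besselKernel r (t + φ * Complex.I) := by
  refine (integrable_exp_half_sub_mul_cosh h).mono' ?_
    (.of_forall fun t => (norm_besselKernel r t φ).le)
  exact ((continuous_besselKernel r).comp (by fun_prop)).aestronglyMeasurable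

theorem hasDerivAt_integral_besselKernel {r φ : ℝ} (hr : 0 < r) (hφ : 0 < cos φ) :
    HasDerivAt (fun θ : ℝ => ∫ t : ℝ, besselKernel r (t + θ * Complex.I)) 0 φ := by
  set D : ℝ → ℝ → ℂ := fun θ t => besselKernel r (t + θ * Complex.I) *
    (1 / 2 - r * Complex.sinh (t + θ * Complex.I)) with hD
  have hDcont : Continuous (D φ) :=
    ((continuous_besselKernel r).comp (by fun_prop)).mul (by fun_prop)
  have hs : {θ : ℝ | cos φ / 2 < cos θ} ∈ nhds φ :=
    (isOpen_lt continuous_const continuous_cos).mem_nhds (half_lt_self hφ)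
  have ha : 0 < r * (cos φ / 2) := by positivity
  have hbound : ∀ t : ℝ, ∀ θ ∈ {θ : ℝ | cos φ / 2 < cos θ}, ‖D θ t * Complex.I‖ ≤
      1 / 2 * exp (t / 2 - r * (cos φ / 2) * cosh t) +
        r * (cosh t * exp (t / 2 - r * (cos φ / 2) * cosh t)) := by
    intro t θ hθ
    have hc := cosh_pos t
    have h₁ : ‖besselKernel r (t + θ * Complex.I)‖ ≤
        exp (t / 2 - r * (cos φ / 2) * cosh t) := by
      rw [norm_besselKernel]
      have : cos φ / 2 ≤ cos θ := le_of_lt hθ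
      gcongr
    have h₂ : ‖(1 / 2 - r * Complex.sinh (t + θ * Complex.I) : ℂ)‖ ≤ 1 / 2 + r * cosh t := by
      refine (norm_sub_le _ _).trans (add_le_add (by simp) ?_)
      rw [norm_mul, Complex.norm_of_nonneg hr.le]
      gcongr
      simpa using Complex.norm_sinh_le_cosh_re (t + θ * Complex.I)
    rw [hD, norm_mul, norm_mul, Complex.norm_I, mul_one]
    exact (mul_le_mul h₁ h₂ (norm_nonneg _) (exp_pos _).le).trans_eq (by ring)
  have hderiv := hasDerivAt_integral_of_dominated_loc_of_deriv_le (μ := volume)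
    (F := fun (θ t : ℝ) => besselKernel r (t + θ * Complex.I))
    (F' := fun θ t => D θ t * Complex.I) hs
    (.of_forall fun θ => ((continuous_besselKernel r).comp (by fun_prop)).aestronglyMeasurable)
    (integrable_besselKernel (mul_pos hr hφ))
    (hDcont.mul continuous_const).aestronglyMeasurable (.of_forall hbound)
    (((integrable_exp_half_sub_mul_cosh ha).const_mul _).add
      ((integrable_cosh_mul_exp_half_sub_mul_cosh ha).const_mul _))
    (.of_forall fun t θ _ => by
      have h : HasDerivAt (fun θ : ℝ => (t + θ * Complex.I : ℂ)) Complex.I θ := by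
        simpa using ((hasDerivAt_id θ).ofReal_comp.mul_const Complex.I).const_add (t : ℂ)
      exact (hasDerivAt_besselKernel r _).comp θ h)
  have hDint : Integrable (D φ) := by
    simpa [mul_assoc] using hderiv.1.mul_const (-Complex.I)
  have hzero : ∫ t, D φ t = 0 := by
    refine integral_eq_zero_of_hasDerivAt_of_integrable (fun t => ?_) hDint
      (integrable_besselKernel (mul_pos hr hφ))
    have h : HasDerivAt (fun t : ℝ => (t + φ * Complex.I : ℂ)) 1 t := by
      simpa using (hasDerivAt_id t).ofReal_comp.add_const (φ * Complex.I)
    simpa [hD, Function.comp_def] using (hasDerivAt_besselKernel r _).comp t h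
  simpa [integral_mul_const, hzero] using hderiv.2

theorem integral_besselKernel_add_mul_I {r φ : ℝ} (hr : 0 < r) (hφ₀ : 0 ≤ φ)
    (hφ : φ < π / 2) :
    ∫ t : ℝ, besselKernel r (t + φ * Complex.I) = ∫ t : ℝ, besselKernel r t := by
  have hderiv : ∀ θ ∈ Set.Icc 0 φ,
      HasDerivAt (fun θ : ℝ => ∫ t : ℝ, besselKernel r (t + θ * Complex.I)) 0 θ := fun θ hθ =>
    hasDerivAt_integral_besselKernel hr
      (cos_pos_of_mem_Ioo ⟨by linarith [hθ.1, pi_pos], by linarith [hθ.2]⟩)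
  simpa using constant_of_has_deriv_right_zero
    (fun θ hθ => (hderiv θ hθ).continuousAt.continuousWithinAt)
    (fun θ hθ => (hderiv θ ⟨hθ.1, hθ.2.le⟩).hasDerivWithinAt) φ ⟨hφ₀, le_rfl⟩

theorem integral_cosh_half_mul_of_even {k : ℝ → ℝ} (hk : ∀ t, k (-t) = k t)
    (hint : Integrable fun t => exp (t / 2) * k t) :
    ∫ t, cosh (t / 2) * k t = ∫ t, exp (t / 2) * k t := by
  have hneg : ∫ t, exp (-t / 2) * k (-t) = ∫ t, exp (t / 2) * k t :=
    integral_neg_eq_self (fun t => exp (t / 2) * k t) volume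
  have hsum := integral_add hint hint.comp_neg
  rw [hneg] at hsum
  have h : ∀ t, cosh (t / 2) * k t =
      (exp (t / 2) * k t + exp (-t / 2) * k (-t)) / 2 := fun t => by
    rw [cosh_eq, hk, neg_div]
    ring
  simp_rw [h, integral_div, hsum]
  ring

theorem integral_eq_integral_deriv_mul_comp {f f' : ℝ → ℝ} (hf : Function.Bijective f)
    (hderiv : ∀ x, HasDerivAt f (f' x) x) (hpos : ∀ x, 0 ≤ f' x) (g : ℝ → ℝ) :
    ∫ x, g x = ∫ x, f' x * g (f x) := by
  have h := integral_image_eq_integral_abs_deriv_smul MeasurableSet.univ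
    (fun x _ => (hderiv x).hasDerivWithinAt) hf.injective.injOn g
  rw [Set.image_univ, hf.surjective.range_eq] at h
  simpa [abs_of_nonneg (hpos _)] using h

theorem integral_exp_half_sub_mul_cosh {r : ℝ} (hr : 0 < r) :
    ∫ t : ℝ, exp (t / 2 - r * cosh t) = √(2 * π / r) * exp (-r) := by
  have hsplit : ∀ t, exp (t / 2 - r * cosh t) = exp (t / 2) * exp (-(r * cosh t)) := fun t => by
    rw [← exp_add, sub_eq_add_neg]
  have hint := integrable_exp_half_sub_mul_cosh hr
  simp_rw [hsplit] at hint ⊢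
  rw [← integral_cosh_half_mul_of_even (fun t => by rw [cosh_neg]) hint]
  have hsubst := integral_eq_integral_deriv_mul_comp (f := fun t => sinh (t / 2))
    (f' := fun t => cosh (t / 2) * (1 / 2))
    (sinh_bijective.comp (Equiv.divRight₀ (2 : ℝ) two_ne_zero).bijective)
    (fun t => ((hasDerivAt_id t).div_const 2).sinh)
    (fun t => by have := cosh_pos (t / 2); positivity)
    (fun v => exp (-(2 * r) * v ^ 2))
  rw [integral_gaussian] at hsubst
  have h : ∀ t, cosh (t / 2) * exp (-(r * cosh t)) = 2 * exp (-r) *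
      (cosh (t / 2) * (1 / 2) * exp (-(2 * r) * sinh (t / 2) ^ 2)) := fun t => by
    have hexp : exp (-(r * cosh t)) = exp (-r) * exp (-(2 * r) * sinh (t / 2) ^ 2) := by
      rw [← exp_add, cosh_eq_one_add_two_mul_sinh_half_sq t]
      ring_nf
    rw [hexp]
    ring
  simp_rw [h]
  rw [integral_const_mul, ← hsubst]
  have hsqrt : √(2 * π / r) = 2 * √(π / (2 * r)) := by
    rw [show 2 * π / r = 2 ^ 2 * (π / (2 * r)) by field_simp, sqrt_mul (by positivity),
      sqrt_sq zero_le_two]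
  rw [hsqrt]
  ring

theorem re_exp_mul_besselKernel (r φ t : ℝ) :
    (Complex.exp (-(φ / 2 : ℝ) * Complex.I) * besselKernel r (t + φ * Complex.I)).re =
      exp (t / 2) * (cos (r * sin φ * sinh t) * exp (-(r * cos φ) * cosh t)) := by
  have h : Complex.exp (-(φ / 2 : ℝ) * Complex.I) * besselKernel r (t + φ * Complex.I) =
      Complex.exp ((t / 2 - r * cos φ * cosh t : ℝ) +
        (-(r * sin φ * sinh t) : ℝ) * Complex.I) := by
    rw [besselKernel_add_mul_I, ← Complex.exp_add]
    push_cast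
    ring_nf
  rw [h, Complex.exp_add, ← Complex.ofReal_exp, Complex.re_ofReal_mul, Complex.exp_ofReal_mul_I_re, cos_neg,
    sub_eq_add_neg, exp_add]
  ring_nf

theorem integral_cosh_half_mul_cos_mul_exp {r φ : ℝ} (hr : 0 < r) (hφ₀ : 0 ≤ φ)
    (hφ : φ < π / 2) :
    ∫ t, cosh (t / 2) * (cos (r * sin φ * sinh t) * exp (-(r * cos φ) * cosh t)) =
      cos (φ / 2) * (√(2 * π / r) * exp (-r)) := by
  have hcos : 0 < cos φ := cos_pos_of_mem_Ioo ⟨by linarith [pi_pos], hφ⟩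
  have hint := (integrable_besselKernel (mul_pos hr hcos)).const_mul
    (Complex.exp (-(φ / 2 : ℝ) * Complex.I))
  have hre := hint.re
  simp only [RCLike.re_eq_complex_re, re_exp_mul_besselKernel] at hre
  rw [integral_cosh_half_mul_of_even (fun t => by simp) hre]
  simp_rw [← re_exp_mul_besselKernel]
  have hreal : ∫ t : ℝ, besselKernel r t = ((√(2 * π / r) * exp (-r) : ℝ) : ℂ) := by
    rw [← integral_exp_half_sub_mul_cosh hr, ← integral_complex_ofReal]
    simp [besselKernel]
  refine (integral_re hint).trans ?_
  rw [RCLike.re_eq_complex_re, integral_const_mul, integral_besselKernel_add_mul_I hr hφ₀ hφ, hreal]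
  rw [Complex.re_mul_ofReal, ← Complex.ofReal_neg, Complex.exp_ofReal_mul_I_re, cos_neg]

theorem stmt6 :
    ∫ x in Set.Ioi (0:ℝ),
        Real.sqrt (Real.sqrt (x^2 + 9) + 3) / Real.sqrt (x^2 + 9)
          * Real.cos (12 * x) * Real.exp (-5 * Real.sqrt (x^2 + 9))
      = 3 * Real.sqrt π / (13 * Real.exp 39) := by
  set f : ℝ → ℝ := fun x => √(√(x ^ 2 + 9) + 3) / √(x ^ 2 + 9) * cos (12 * x) *
    exp (-5 * √(x ^ 2 + 9)) with hf
  have heven : ∀ x, f |x| = f x := fun x => by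
    rcases abs_choice x with h | h <;> simp [hf, h]
  have habs := integral_comp_abs (f := f)
  simp_rw [heven] at habs
  have hsubst := integral_eq_integral_deriv_mul_comp (f := fun t => 3 * sinh t)
    (f' := fun t => 3 * cosh t)
    ((Equiv.mulLeft₀ (3 : ℝ) three_ne_zero).bijective.comp sinh_bijective)
    (fun t => (hasDerivAt_sinh t).const_mul 3)
    (fun t => by have := cosh_pos t; positivity) f
  set φ := arccos (5 / 13) with hφ
  have hcos : cos φ = 5 / 13 := cos_arccos (by norm_num) (by norm_num)
  have hsin : sin φ = 12 / 13 := by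
    rw [hφ, sin_arccos, show (1 - (5 / 13) ^ 2 : ℝ) = (12 / 13) ^ 2 by norm_num,
      sqrt_sq (by norm_num)]
  have hφ_lt : φ < π / 2 := arccos_lt_pi_div_two.2 (by norm_num)
  have hcos_half : cos (φ / 2) = √(9 / 13) := by
    rw [cos_half (by linarith [arccos_nonneg (5 / 13), pi_pos]) (arccos_le_pi _), hcos]
    norm_num
  have hval := integral_cosh_half_mul_cos_mul_exp (r := 39) (by norm_num)
    (arccos_nonneg (5 / 13)) hφ_lt
  have hintegrand : ∀ t, 3 * cosh t * f (3 * sinh t) = √6 *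
      (cosh (t / 2) * (cos (39 * sin φ * sinh t) * exp (-(39 * cos φ) * cosh t))) := fun t => by
    have hc := cosh_pos t
    have h₁ : √((3 * sinh t) ^ 2 + 9) = 3 * cosh t := by
      rw [show (3 * sinh t) ^ 2 + 9 = (3 * cosh t) ^ 2 by rw [mul_pow, mul_pow, cosh_sq]; ring,
        sqrt_sq (by positivity)]
    have h₂ : √(3 * cosh t + 3) = √6 * cosh (t / 2) := by
      have h := cosh_two_mul (t / 2)
      rw [mul_div_cancel₀ t two_ne_zero, sinh_sq] at h
      rw [show 3 * cosh t + 3 = 6 * cosh (t / 2) ^ 2 by linarith, sqrt_mul (by norm_num),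
        sqrt_sq (cosh_pos _).le]
    simp only [hf, h₁, h₂, hcos, hsin]
    field_simp
    ring_nf
  simp_rw [hintegrand] at hsubst
  rw [integral_const_mul, hval, hcos_half] at hsubst
  have hsqrt : √6 * (√(9 / 13) * √(2 * π / 39)) = 6 / 13 * √π := by
    rw [← sqrt_mul (by norm_num), ← sqrt_mul (by norm_num),
      show (6 * (9 / 13 * (2 * π / 39)) : ℝ) = (6 / 13) ^ 2 * π by ring,
      sqrt_mul (by norm_num), sqrt_sq (by norm_num)]
  have hfin : ∫ x in Set.Ioi (0 : ℝ), f x = 3 / 13 * √π * exp (-39) := by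
    linear_combination (-1 / 2) * habs + 1 / 2 * hsubst + 1 / 2 * exp (-39) * hsqrt
  rw [hfin, exp_neg]
  field_simp
end

section
/- For real a > 0 and b ≥ 0, the integral over x from 0 to ∞ of sin(b·√(x(x+1)))/√(x+1) · e^{-ax} equals √(π/2) · √(√(a²+b²)−a)/√(a²+b²) · e^{(a−√(a²+b²))/2}. -/
open Real MeasureTheory

/-- Moving the line of integration inside a horizontal strip on which the integrand and its
derivative are dominated by an integrable function of the real part. -/
theorem integral_add_mul_I_eq_of_bound {f f' : ℂ → ℂ} {g : ℝ → ℝ} {T t : ℝ}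
    (hf : ∀ z, HasDerivAt f (f' z) z) (hf' : Continuous f') (hg : Integrable g)
    (hfg : ∀ z : ℂ, |z.im| < T → ‖f z‖ ≤ g z.re)
    (hfg' : ∀ z : ℂ, |z.im| < T → ‖f' z‖ ≤ g z.re) (ht : |t| < T) :
    ∫ v : ℝ, f (v + t * Complex.I) = ∫ v : ℝ, f v := by
  have hfc : Continuous f := continuous_iff_continuousAt.2 fun z => (hf z).continuousAt
  have hint : ∀ s : ℝ, |s| < T → Integrable fun v : ℝ => f (v + s * Complex.I) := fun s hs =>
    hg.mono' (by fun_prop) (.of_forall fun v => by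
      simpa using hfg (v + s * Complex.I) (by simpa using hs))
  have hint' : ∀ s : ℝ, |s| < T → Integrable fun v : ℝ => f' (v + s * Complex.I) := fun s hs =>
    hg.mono' (by fun_prop) (.of_forall fun v => by
      simpa using hfg' (v + s * Complex.I) (by simpa using hs))
  have hzero : ∀ s : ℝ, |s| < T → ∫ v : ℝ, f' (v + s * Complex.I) = 0 := fun s hs =>
    integral_eq_zero_of_hasDerivAt_of_integrable (f := fun v : ℝ => f (v + s * Complex.I))
      (fun v => by
        have h := (hf (v + s * Complex.I)).comp (v : ℂ)
          ((hasDerivAt_id (v : ℂ)).add_const (s * Complex.I))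
        simpa using h.comp_ofReal)
      (hint' s hs) (hint s hs)
  have hopen : IsOpen {s : ℝ | |s| < T} := isOpen_lt (by fun_prop) (by fun_prop)
  have hderiv : ∀ s : ℝ, |s| < T →
      HasDerivAt (fun s : ℝ => ∫ v : ℝ, f (v + s * Complex.I)) 0 s := by
    intro s hs
    have h := (hasDerivAt_integral_of_dominated_loc_of_deriv_le (μ := volume) (bound := g)
      (F := fun (s v : ℝ) => f (v + s * Complex.I))
      (F' := fun (s v : ℝ) => f' (v + s * Complex.I) * Complex.I)
      (hopen.mem_nhds hs) (.of_forall fun s => by fun_prop) (hint s hs) (by fun_prop)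
      (.of_forall fun v s hs => by
        simpa using hfg' (v + s * Complex.I) (by simpa using hs)) hg
      (.of_forall fun v s hs => by
        have h := (hf (v + s * Complex.I)).comp (s : ℂ)
          (((hasDerivAt_id (s : ℂ)).mul_const Complex.I).const_add (v : ℂ))
        simpa using h.comp_ofReal)).2
    simpa [integral_mul_const, hzero s hs] using h
  have hconv : IsPreconnected {s : ℝ | |s| < T} := by
    have : {s : ℝ | |s| < T} = Set.Ioo (-T) T := by ext s; simp [abs_lt]
    rw [this]; exact isPreconnected_Ioo
  have h := hopen.is_const_of_deriv_eq_zero hconv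
    (fun s hs => (hderiv s hs).differentiableAt.differentiableWithinAt)
    (fun s hs => (hderiv s hs).deriv) (x := t) (y := 0) ht
    (by simpa using (abs_nonneg t).trans_lt ht)
  simpa using h

theorem Complex.norm_cosh_le_cosh_re (z : ℂ) : ‖Complex.cosh z‖ ≤ Real.cosh z.re := by
  rw [Complex.cosh, norm_div, Real.cosh_eq]
  have := norm_add_le (Complex.exp z) (Complex.exp (-z))
  simp only [Complex.norm_exp, Complex.neg_re] at this
  simpa using div_le_div_of_nonneg_right this zero_le_two

theorem Complex.cosh_re_eq (z : ℂ) : (Complex.cosh z).re = Real.cosh z.re * Real.cos z.im := by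
  conv_lhs => rw [← Complex.re_add_im z]
  rw [Complex.cosh_add, Complex.cosh_mul_I, Complex.sinh_mul_I]
  rw [← Complex.ofReal_cosh, ← Complex.ofReal_cos, ← Complex.ofReal_sin, ← Complex.ofReal_sinh,
    Complex.add_re, Complex.re_ofReal_mul, Complex.re_ofReal_mul, Complex.re_ofReal_mul]
  simp only [Complex.ofReal_re, Complex.I_re, mul_zero, add_zero]

theorem Real.cosh_sq_mul_exp_neg_le {K : ℝ} (hK : 0 < K) (v : ℝ) :
    cosh v ^ 2 * exp (-(K * cosh v)) ≤ 24 / K ^ 4 * (1 + v ^ 2)⁻¹ := by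
  have hc := cosh_pos v
  have h4 := pow_div_factorial_le_exp (K * cosh v) (by positivity) 4
  have hs : v ^ 2 ≤ sinh v ^ 2 := by
    rw [sq_le_sq, abs_sinh]
    exact self_le_sinh_iff.2 (abs_nonneg v)
  have h1 : 1 + v ^ 2 ≤ cosh v ^ 2 := by rw [cosh_sq']; linarith
  have hexp : exp (-(K * cosh v)) ≤ 24 / (K * cosh v) ^ 4 := by
    rw [exp_neg, inv_le_comm₀ (exp_pos _) (by positivity), inv_div]
    simpa [Nat.factorial] using h4
  calc cosh v ^ 2 * exp (-(K * cosh v)) ≤ cosh v ^ 2 * (24 / (K * cosh v) ^ 4) := by gcongr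
    _ = 24 / K ^ 4 * (cosh v ^ 2)⁻¹ := by field_simp
    _ ≤ _ := by gcongr

theorem integral_cosh_half_mul_exp_neg_mul_cosh (k : ℝ) :
    ∫ v : ℝ, cosh (v / 2) * exp (-(k * cosh v)) = 2 * exp (-k) * √(π / (2 * k)) := by
  have hd : ∀ v : ℝ, HasDerivAt (fun v => sinh (v / 2)) (cosh (v / 2) / 2) v := fun v => by
    simpa [div_eq_mul_inv] using ((hasDerivAt_id v).div_const 2).sinh
  have hinj : Function.Injective fun v : ℝ => sinh (v / 2) := fun x y h => by
    have := sinh_injective h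
    linarith
  have himg : (fun v : ℝ => sinh (v / 2)) '' Set.univ = Set.univ := by
    rw [Set.image_univ, Set.range_eq_univ]
    intro y
    exact ⟨2 * arsinh y, by simp⟩
  have h := integral_image_eq_integral_abs_deriv_smul MeasurableSet.univ
    (fun v _ => (hd v).hasDerivWithinAt) hinj.injOn
    (fun s => 2 * exp (-k) * exp (-(2 * k) * s ^ 2))
  rw [himg, setIntegral_univ, setIntegral_univ, integral_const_mul, integral_gaussian] at h
  rw [h]
  congr 1 with v
  have hv : cosh v = 1 + 2 * sinh (v / 2) ^ 2 := by
    have := cosh_two_mul (v / 2)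
    rw [mul_div_cancel₀ v two_ne_zero, cosh_sq] at this
    linarith
  rw [hv, abs_of_pos (by have := cosh_pos (v / 2); positivity), smul_eq_mul, mul_assoc 2,
    ← exp_add]
  ring_nf

theorem integral_sinh_half_mul_exp_mul_sin {k θ : ℝ} (hk : 0 < k) (hθ : |θ| < π / 2) :
    ∫ v : ℝ, sinh (v / 2) * exp (-(k * cos θ * cosh v)) * sin (k * sin θ * sinh v)
      = sin (θ / 2) * (2 * exp (-k) * √(π / (2 * k))) := by
  set α : ℂ := θ / 2 * Complex.I with hα
  let f : ℂ → ℂ := fun z => Complex.sinh (z / 2 + α) * Complex.exp (-(k * Complex.cosh z))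
  let f' : ℂ → ℂ := fun z => (Complex.cosh (z / 2 + α) / 2
    - k * Complex.sinh (z / 2 + α) * Complex.sinh z) * Complex.exp (-(k * Complex.cosh z))
  obtain ⟨T, hθT, hTπ⟩ := exists_between hθ
  have hT0 : 0 < T := (abs_nonneg θ).trans_lt hθT
  have hc : 0 < cos T := cos_pos_of_mem_Ioo ⟨by linarith, hTπ⟩
  let g : ℝ → ℝ := fun v => (1 + k) * (24 / (k * cos T) ^ 4 * (1 + v ^ 2)⁻¹)
  have hg : Integrable g := (integrable_inv_one_add_sq.const_mul _).const_mul _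
  have hf : ∀ z, HasDerivAt f (f' z) z := fun z => by
    have h1 := (((hasDerivAt_id z).div_const 2).add_const α).csinh
    have h2 := (((Complex.hasDerivAt_cosh z).const_mul (k : ℂ)).neg).cexp
    refine (h1.mul h2).congr_deriv ?_
    simp only [f', id, Pi.neg_apply]
    ring
  have hf' : Continuous f' := by fun_prop
  have hexp : ∀ z : ℂ, |z.im| < T →
      ‖Complex.exp (-(k * Complex.cosh z))‖ ≤ exp (-(k * cos T * cosh z.re)) := fun z hz => by
    have hcos : cos T ≤ cos z.im := by
      rw [← cos_abs z.im]
      exact cos_le_cos_of_nonneg_of_le_pi (abs_nonneg _) (by linarith [pi_pos]) hz.le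
    have := cosh_pos z.re
    rw [Complex.norm_exp, exp_le_exp, Complex.neg_re, Complex.re_ofReal_mul, Complex.cosh_re_eq,
      neg_le_neg_iff, mul_assoc, mul_comm (cos T)]
    gcongr
  have hre : ∀ z : ℂ, (z / 2 + α).re = z.re / 2 := fun z => by simp [hα]
  have hhalf : ∀ x : ℝ, cosh (x / 2) ≤ cosh x := fun x => by
    rw [cosh_le_cosh, abs_div, abs_two]
    linarith [abs_nonneg x]
  have hfg : ∀ z : ℂ, |z.im| < T → ‖f z‖ ≤ g z.re := fun z hz => by
    have h1 := one_le_cosh z.re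
    calc ‖f z‖ ≤ cosh z.re * exp (-(k * cos T * cosh z.re)) := by
          rw [norm_mul]
          gcongr
          · exact (Complex.norm_sinh_le_cosh_re _).trans (by rw [hre]; exact hhalf _)
          · exact hexp z hz
      _ ≤ ((1 + k) * cosh z.re ^ 2) * exp (-(k * cos T * cosh z.re)) := by
          gcongr
          nlinarith [mul_nonneg hk.le (sq_nonneg (cosh z.re))]
      _ ≤ g z.re := by
          rw [mul_assoc]
          exact mul_le_mul_of_nonneg_left (cosh_sq_mul_exp_neg_le (by positivity) _)
            (by positivity)
  have hfg' : ∀ z : ℂ, |z.im| < T → ‖f' z‖ ≤ g z.re := fun z hz => by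
    have h1 := one_le_cosh z.re
    have hs : ‖Complex.sinh (z / 2 + α)‖ ≤ cosh z.re :=
      (Complex.norm_sinh_le_cosh_re _).trans (by rw [hre]; exact hhalf _)
    have hch : ‖Complex.cosh (z / 2 + α)‖ ≤ cosh z.re :=
      (Complex.norm_cosh_le_cosh_re _).trans (by rw [hre]; exact hhalf _)
    have hs' := Complex.norm_sinh_le_cosh_re z
    calc ‖f' z‖ ≤ (cosh z.re / 2 + k * cosh z.re * cosh z.re)
            * exp (-(k * cos T * cosh z.re)) := by
          rw [norm_mul]
          gcongr
          · refine (norm_sub_le _ _).trans ?_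
            rw [norm_div, norm_mul, norm_mul, Complex.norm_of_nonneg hk.le, Complex.norm_two]
            gcongr
          · exact hexp z hz
      _ ≤ ((1 + k) * cosh z.re ^ 2) * exp (-(k * cos T * cosh z.re)) := by
          gcongr
          nlinarith
      _ ≤ g z.re := by
          rw [mul_assoc]
          exact mul_le_mul_of_nonneg_left (cosh_sq_mul_exp_neg_le (by positivity) _)
            (by positivity)
  have hshift := integral_add_mul_I_eq_of_bound (t := -θ) hf hf' hg hfg hfg' (by rwa [abs_neg])
  have hfc : Continuous f := by fun_prop
  have hint : ∀ s : ℝ, |s| < T → Integrable fun v : ℝ => f (v + s * Complex.I) := fun s hs =>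
    hg.mono' (by fun_prop) (.of_forall fun v => by
      simpa using hfg (v + s * Complex.I) (by simpa using hs))
  have hint0 : Integrable fun v : ℝ => f v := by simpa using hint 0 (by simpa using hT0)
  have him := congrArg Complex.im hshift
  have e1 := integral_im (hint (-θ) (by rwa [abs_neg]))
  have e2 := integral_im hint0
  simp only [RCLike.im_to_complex] at e1 e2
  rw [← e1, ← e2] at him
  have hleft : ∀ v : ℝ, (f (v + (-θ : ℝ) * Complex.I)).im
      = sinh (v / 2) * exp (-(k * cos θ * cosh v)) * sin (k * sin θ * sinh v) := fun v => by
    have h1 : ((v : ℂ) + (-θ : ℝ) * Complex.I) / 2 + α = ((v / 2 : ℝ) : ℂ) := by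
      rw [hα]; push_cast; ring
    have h2 : -(k * Complex.cosh ((v : ℂ) + (-θ : ℝ) * Complex.I))
        = ((-(k * cos θ * cosh v) : ℝ) : ℂ) + ((k * sin θ * sinh v : ℝ) : ℂ) * Complex.I := by
      rw [Complex.cosh_add, Complex.cosh_mul_I, Complex.sinh_mul_I]
      push_cast
      rw [Complex.cos_neg, Complex.sin_neg]
      ring
    simp only [f]
    rw [h1, h2, ← Complex.ofReal_sinh, Complex.im_ofReal_mul, Complex.exp_im]
    simp only [Complex.add_re, Complex.add_im, Complex.ofReal_re, Complex.ofReal_im,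
      Complex.re_ofReal_mul, Complex.im_ofReal_mul, Complex.I_re, Complex.I_im, mul_zero, mul_one,
      add_zero, zero_add, mul_assoc]
  have hright : ∀ v : ℝ, (f v).im
      = sin (θ / 2) * (cosh (v / 2) * exp (-(k * cosh v))) := fun v => by
    have h1 : (v : ℂ) / 2 + α = ((v / 2 : ℝ) : ℂ) + ((θ / 2 : ℝ) : ℂ) * Complex.I := by
      rw [hα]; push_cast; ring
    have h2 : Complex.exp (-(k * Complex.cosh v)) = ((exp (-(k * cosh v)) : ℝ) : ℂ) := by
      push_cast; ring_nf
    simp only [f]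
    rw [h1, h2, Complex.im_mul_ofReal, Complex.sinh_add, Complex.cosh_mul_I, Complex.sinh_mul_I,
      ← Complex.ofReal_sinh, ← Complex.ofReal_cosh, ← Complex.ofReal_sin, ← Complex.ofReal_cos,
      Complex.add_im, Complex.im_ofReal_mul, Complex.im_ofReal_mul, Complex.im_ofReal_mul,
      Complex.ofReal_im, Complex.I_im]
    ring
  simp only [hleft, hright] at him
  rw [him, integral_const_mul, integral_cosh_half_mul_exp_neg_mul_cosh]

theorem setIntegral_sinh_half_sq_substitution (a b : ℝ) :
    ∫ x in Set.Ioi (0 : ℝ), sin (b * √(x * (x + 1))) / √(x + 1) * exp (-a * x)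
      = exp (a / 2) * ∫ v in Set.Ioi (0 : ℝ),
          sinh (v / 2) * exp (-(a / 2 * cosh v)) * sin (b / 2 * sinh v) := by
  have hd : ∀ v : ℝ, HasDerivAt (fun v => sinh (v / 2) ^ 2) (sinh (v / 2) * cosh (v / 2)) v :=
    fun v => by
      refine ((((hasDerivAt_id v).div_const 2).sinh).pow 2).congr_deriv ?_
      simp only [id]
      ring
  have hinj : Set.InjOn (fun v : ℝ => sinh (v / 2) ^ 2) (Set.Ioi 0) := fun x hx y hy h => by
    have hx' : 0 ≤ sinh (x / 2) := sinh_nonneg_iff.2 (half_pos hx).le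
    have hy' : 0 ≤ sinh (y / 2) := sinh_nonneg_iff.2 (half_pos hy).le
    have := sinh_injective ((sq_eq_sq₀ hx' hy').1 h)
    linarith
  have himg : (fun v : ℝ => sinh (v / 2) ^ 2) '' Set.Ioi 0 = Set.Ioi 0 := by
    ext y
    constructor
    · rintro ⟨v, hv, rfl⟩
      exact pow_pos (sinh_pos_iff.2 (half_pos hv)) 2
    · intro hy
      refine ⟨2 * arsinh √y, ?_, ?_⟩
      · exact mul_pos two_pos (arsinh_pos_iff.2 (sqrt_pos.2 hy))
      · simp [sq_sqrt (le_of_lt hy)]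
  have h := integral_image_eq_integral_abs_deriv_smul measurableSet_Ioi
    (fun v _ => (hd v).hasDerivWithinAt) hinj
    (fun x => sin (b * √(x * (x + 1))) / √(x + 1) * exp (-a * x))
  rw [himg] at h
  rw [h, ← integral_const_mul]
  refine setIntegral_congr_fun measurableSet_Ioi fun v hv => ?_
  have hs : 0 < sinh (v / 2) := sinh_pos_iff.2 (half_pos hv)
  have hc := cosh_pos (v / 2)
  have h1 : sinh (v / 2) ^ 2 + 1 = cosh (v / 2) ^ 2 := (cosh_sq _).symm
  have hv1 : cosh v = 1 + 2 * sinh (v / 2) ^ 2 := by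
    have := cosh_two_mul (v / 2)
    rw [mul_div_cancel₀ v two_ne_zero, cosh_sq] at this
    linarith
  have hv2 : sinh v = 2 * sinh (v / 2) * cosh (v / 2) := by
    rw [← sinh_two_mul, mul_div_cancel₀ v two_ne_zero]
  have he : exp (-a * sinh (v / 2) ^ 2) = exp (a / 2) * exp (-(a / 2 * cosh v)) := by
    rw [← exp_add, hv1]
    ring_nf
  have hsin : b * (sinh (v / 2) * cosh (v / 2)) = b / 2 * sinh v := by rw [hv2]; ring
  simp only [smul_eq_mul]
  rw [h1, ← mul_pow, sqrt_sq (by positivity), sqrt_sq hc.le, abs_of_pos (by positivity), he, hsin]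
  field_simp

theorem integral_even_sinh_half_mul_exp_mul_sin (p q : ℝ) :
    ∫ v : ℝ, sinh (v / 2) * exp (-(p * cosh v)) * sin (q * sinh v)
      = 2 * ∫ v in Set.Ioi (0 : ℝ), sinh (v / 2) * exp (-(p * cosh v)) * sin (q * sinh v) := by
  rw [← integral_comp_abs]
  congr 1 with v
  rcases abs_choice v with h | h <;> rw [h]
  simp [neg_div]

theorem stmt12 (a b : ℝ) (ha : 0 < a) (hb : 0 ≤ b) :
    ∫ x in Set.Ioi (0:ℝ),
        Real.sin (b * Real.sqrt (x * (x + 1))) / Real.sqrt (x + 1) * Real.exp (-a * x)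
      = Real.sqrt (π / 2) * Real.sqrt (Real.sqrt (a^2 + b^2) - a) / Real.sqrt (a^2 + b^2)
        * Real.exp ((a - Real.sqrt (a^2 + b^2)) / 2) := by
  set r := √(a ^ 2 + b ^ 2) with hr
  have hr2 : r ^ 2 = a ^ 2 + b ^ 2 := sq_sqrt (by positivity)
  have hr0 : 0 < r := sqrt_pos.2 (by positivity)
  have har : a ≤ r := le_sqrt_of_sq_le (by nlinarith)
  set θ := arccos (a / r) with hθ
  have hcos : r * cos θ = a := by
    rw [hθ, cos_arccos (by linarith [div_pos ha hr0]) ((div_le_one hr0).2 har)]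
    field_simp
  have hsin : r * sin θ = b := by
    have hdiv : 1 - (a / r) ^ 2 = (b / r) ^ 2 := by
      field_simp
      linarith
    rw [hθ, sin_arccos, hdiv, sqrt_sq (by positivity)]
    field_simp
  have hθ0 : 0 ≤ θ := arccos_nonneg _
  have hθ1 : θ < π / 2 := arccos_lt_pi_div_two.2 (by positivity)
  have hhalf : sin (θ / 2) = √((r - a) / (2 * r)) := by
    rw [sin_half_eq_sqrt hθ0 (by linarith [pi_pos]), ← hcos]
    congr 1
    field_simp
  have hI := integral_sinh_half_mul_exp_mul_sin (half_pos hr0) (abs_lt.2 ⟨by linarith, hθ1⟩)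
  rw [show r / 2 * cos θ = a / 2 by rw [← hcos]; ring,
    show r / 2 * sin θ = b / 2 by rw [← hsin]; ring,
    integral_even_sinh_half_mul_exp_mul_sin, mul_div_cancel₀ r two_ne_zero, hhalf] at hI
  have hsqrt : √((r - a) / (2 * r)) * √(π / r) = √(π / 2) * √(r - a) / r := by
    have h1 : 0 ≤ r - a := sub_nonneg.2 har
    rw [← sqrt_mul (by positivity), ← sqrt_mul (by positivity)]
    rw [eq_div_iff hr0.ne', ← sqrt_sq hr0.le, ← sqrt_mul (by rw [sqrt_sq hr0.le]; positivity),
      sqrt_sq hr0.le]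
    congr 1
    field_simp
  rw [setIntegral_sinh_half_sq_substitution, ← hsqrt,
    show (a - r) / 2 = a / 2 + -(r / 2) by ring, exp_add]
  linear_combination exp (a / 2) / 2 * hI
end

section
/- The integral over x from 0 to ∞ of √x · cos(4√(x(x+1))) · e^{-3x} equals −9√π/(125e). -/
open Real MeasureTheory

/-- The entire function whose values on the positive real axis give, after the substitution
`x = sinh² t`, the integrand `√x cos (4 √(x (x + 1))) exp (-3 x)`. -/
noncomputable def sinhKernel (z : ℂ) : ℂ :=
  Complex.sinh z ^ 2 * Complex.cosh z *
    Complex.exp (-3 * Complex.sinh z ^ 2 + 4 * Complex.I * (Complex.sinh z * Complex.cosh z))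

theorem differentiable_sinhKernel : Differentiable ℂ sinhKernel := by
  unfold sinhKernel
  fun_prop

theorem continuous_sinhKernel : Continuous sinhKernel :=
  differentiable_sinhKernel.continuous

theorem sinh_add_mul_I (x y : ℝ) : Complex.sinh (x + y * Complex.I)
    = ⟨Real.sinh x * Real.cos y, Real.cosh x * Real.sin y⟩ := by
  rw [Complex.sinh_add, Complex.sinh_mul_I, Complex.cosh_mul_I, ← Complex.ofReal_sinh,
    ← Complex.ofReal_cosh, ← Complex.ofReal_sin, ← Complex.ofReal_cos]
  apply Complex.ext <;> simp [-Complex.ofReal_sinh, -Complex.ofReal_cosh, -Complex.ofReal_sin,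
    -Complex.ofReal_cos]

theorem cosh_add_mul_I (x y : ℝ) : Complex.cosh (x + y * Complex.I)
    = ⟨Real.cosh x * Real.cos y, Real.sinh x * Real.sin y⟩ := by
  rw [Complex.cosh_add, Complex.sinh_mul_I, Complex.cosh_mul_I, ← Complex.ofReal_sinh,
    ← Complex.ofReal_cosh, ← Complex.ofReal_sin, ← Complex.ofReal_cos]
  apply Complex.ext <;> simp [-Complex.ofReal_sinh, -Complex.ofReal_cosh, -Complex.ofReal_sin,
    -Complex.ofReal_cos]

theorem sinhKernel_ofReal_re (x : ℝ) : (sinhKernel x).re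
    = Real.sinh x ^ 2 * Real.cosh x * (Real.cos (4 * (Real.sinh x * Real.cosh x))
      * Real.exp (-3 * Real.sinh x ^ 2)) := by
  unfold sinhKernel
  rw [← Complex.ofReal_sinh, ← Complex.ofReal_cosh, ← Complex.ofReal_pow, ← Complex.ofReal_mul,
    Complex.re_ofReal_mul, Complex.exp_re]
  have h1 : (-3 * ((Real.sinh x ^ 2 : ℝ) : ℂ)
      + 4 * Complex.I * ((Real.sinh x : ℂ) * (Real.cosh x : ℂ)))
      = ⟨-3 * Real.sinh x ^ 2, 4 * (Real.sinh x * Real.cosh x)⟩ := by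
    apply Complex.ext <;> simp [-Complex.ofReal_sinh, -Complex.ofReal_cosh, -Complex.ofReal_pow]
  rw [h1]
  ring

theorem sinhKernel_mul_I_im (y : ℝ) : (sinhKernel (y * Complex.I)).im = 0 := by
  unfold sinhKernel
  rw [Complex.sinh_mul_I, Complex.cosh_mul_I, ← Complex.ofReal_sin, ← Complex.ofReal_cos]
  have h : ((Real.sin y : ℂ) * Complex.I) ^ 2 * (Real.cos y : ℂ) * Complex.exp
      (-3 * ((Real.sin y : ℂ) * Complex.I) ^ 2
        + 4 * Complex.I * ((Real.sin y : ℂ) * Complex.I * (Real.cos y : ℂ)))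
      = ((-Real.sin y ^ 2 * Real.cos y
        * Real.exp (3 * Real.sin y ^ 2 - 4 * Real.sin y * Real.cos y) : ℝ) : ℂ) := by
    push_cast
    congr 1
    · linear_combination (Complex.sin y) ^ 2 * Complex.cos y * Complex.I_sq
    · congr 1
      linear_combination (-3 * (Complex.sin y) ^ 2
        + 4 * Complex.sin y * Complex.cos y) * Complex.I_sq
  rw [h, Complex.ofReal_im]

theorem norm_sinhKernel_le {x y : ℝ} (hs : 0 ≤ Real.sin y) (hc : 0 ≤ Real.cos y)
    (h : 4 / 5 ≤ Real.cos y ^ 2) :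
    ‖sinhKernel (x + y * Complex.I)‖
      ≤ (1 + Real.sinh x ^ 2) ^ 2 * Real.exp (4 - (1 + Real.sinh x ^ 2)) := by
  have hy := Real.sin_sq_add_cos_sq y
  have hx := Real.cosh_sq x
  have hn : ∀ z : ℂ, ‖z‖ ^ 2 = z.re ^ 2 + z.im ^ 2 := fun z => by
    rw [← Complex.normSq_eq_norm_sq, Complex.normSq_apply]; ring
  unfold sinhKernel
  rw [sinh_add_mul_I, cosh_add_mul_I, norm_mul, norm_mul, norm_pow, Complex.norm_exp]
  have hS : ‖(⟨Real.sinh x * Real.cos y, Real.cosh x * Real.sin y⟩ : ℂ)‖ ^ 2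
      ≤ 1 + Real.sinh x ^ 2 := by
    rw [hn]
    nlinarith [sq_nonneg (Real.sinh x), sq_nonneg (Real.cos y)]
  have hC : ‖(⟨Real.cosh x * Real.cos y, Real.sinh x * Real.sin y⟩ : ℂ)‖
      ≤ 1 + Real.sinh x ^ 2 := by
    refine le_of_sq_le_sq ?_ (by positivity)
    rw [hn]
    nlinarith [sq_nonneg (Real.sinh x), sq_nonneg (Real.sin y), sq_nonneg (Real.sinh x ^ 2)]
  have hp := mul_nonneg hs hc
  rw [pow_two (1 + _)]
  gcongr
  simp only [Complex.add_re, Complex.mul_re, Complex.mul_im, pow_two, Complex.neg_re,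
    Complex.neg_im, Complex.I_re, Complex.I_im, Complex.re_ofNat, Complex.im_ofNat]
  have h2 : 0 ≤ (Real.sinh x ^ 2 + Real.cosh x ^ 2) * (Real.sin y * Real.cos y) := by positivity
  nlinarith [mul_nonneg (sq_nonneg (Real.sinh x)) (sub_nonneg.2 h)]

theorem sinhKernel_re_of_cos_sin {β : ℝ} (hc : Real.cos β = 2 / √5) (hs : Real.sin β = 1 / √5)
    (x : ℝ) : (sinhKernel (x + β * Complex.I)).re
      = 2 / (5 * √5 * Real.exp 1) * ((Real.sinh x ^ 2 - 1) * Real.exp (-5 * Real.sinh x ^ 2)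
        * Real.cosh x) := by
  have h5 : √5 ^ 2 = (5 : ℝ) := Real.sq_sqrt (by norm_num)
  have hx := Real.cosh_sq x
  have h1 : (-3 * (⟨Real.sinh x * Real.cos β, Real.cosh x * Real.sin β⟩ : ℂ) ^ 2
      + 4 * Complex.I * ((⟨Real.sinh x * Real.cos β, Real.cosh x * Real.sin β⟩ : ℂ)
        * ⟨Real.cosh x * Real.cos β, Real.sinh x * Real.sin β⟩))
      = ((-5 * Real.sinh x ^ 2 - 1 : ℝ) : ℂ) := by
    rw [hc, hs]
    apply Complex.ext
    · simp only [Complex.add_re, Complex.mul_re, Complex.mul_im, pow_two, Complex.neg_re,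
        Complex.neg_im, Complex.I_re, Complex.I_im, Complex.re_ofNat, Complex.im_ofNat,
        Complex.ofReal_re]
      field_simp
      rw [h5]
      linear_combination (-5) * hx
    · simp only [Complex.add_im, Complex.mul_re, Complex.mul_im, pow_two, Complex.neg_re,
        Complex.neg_im, Complex.I_re, Complex.I_im, Complex.re_ofNat, Complex.im_ofNat,
        Complex.ofReal_im]
      field_simp
      ring
  unfold sinhKernel
  rw [sinh_add_mul_I, cosh_add_mul_I, h1, ← Complex.ofReal_exp, Complex.re_mul_ofReal, hc, hs,
    Real.exp_sub]
  simp only [Complex.mul_re, Complex.mul_im, pow_two]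
  field_simp
  rw [h5]
  linear_combination (-5 : ℝ) * hx

theorem integral_sinhKernel_re {T : ℝ} (hT : 0 ≤ T) :
    ∫ x in (0 : ℝ)..T, (sinhKernel x).re
      = 1 / 2 * ∫ x in (0 : ℝ)..Real.sinh T ^ 2,
        Real.sqrt x * Real.cos (4 * Real.sqrt (x * (x + 1))) * Real.exp (-3 * x) := by
  have hd : ∀ x ∈ Set.uIcc 0 T, HasDerivAt (fun t => Real.sinh t ^ 2)
      (2 * Real.sinh x * Real.cosh x) x := fun x _ => by
    simpa using (Real.hasDerivAt_sinh x).fun_pow 2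
  have key := intervalIntegral.integral_comp_mul_deriv (a := 0) (b := T) hd (by fun_prop)
    (g := fun x => Real.sqrt x * Real.cos (4 * Real.sqrt (x * (x + 1))) * Real.exp (-3 * x))
    (by fun_prop)
  simp only [Real.sinh_zero, ne_eq, OfNat.ofNat_ne_zero, not_false_eq_true, zero_pow] at key
  rw [← key, ← intervalIntegral.integral_const_mul]
  refine intervalIntegral.integral_congr fun x hx => ?_
  rw [Set.uIcc_of_le hT] at hx
  have hs : 0 ≤ Real.sinh x := Real.sinh_nonneg_iff.2 hx.1
  have h1 : Real.sinh x ^ 2 * (Real.sinh x ^ 2 + 1) = (Real.sinh x * Real.cosh x) ^ 2 := by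
    rw [mul_pow, Real.cosh_sq]
  simp only [Function.comp_apply]
  rw [h1, Real.sqrt_sq hs, Real.sqrt_sq (mul_nonneg hs (Real.cosh_pos x).le),
    sinhKernel_ofReal_re]
  ring

theorem integral_sinhKernel_re_shift (T β : ℝ) :
    ∫ x in (0 : ℝ)..T, (sinhKernel x).re
      = (∫ x in (0 : ℝ)..T, (sinhKernel (x + β * Complex.I)).re)
        + (∫ y in (0 : ℝ)..β, sinhKernel (T + y * Complex.I)).im := by
  have hc := continuous_sinhKernel
  have key := congrArg Complex.re (Complex.integral_boundary_rect_eq_zero_of_differentiableOn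
    sinhKernel 0 ⟨T, β⟩ differentiable_sinhKernel.differentiableOn)
  have hl : (∫ y in (0 : ℝ)..β, sinhKernel (y * Complex.I)).im = 0 := by
    have := Complex.imCLM.intervalIntegral_comp_comm (μ := volume) (a := 0) (b := β)
      (f := fun y : ℝ => sinhKernel (y * Complex.I))
      (Continuous.intervalIntegrable (by fun_prop) _ _)
    simpa [sinhKernel_mul_I_im] using this.symm
  have h0 := Complex.reCLM.intervalIntegral_comp_comm (μ := volume) (a := 0) (b := T)
    (f := fun x : ℝ => sinhKernel x) (Continuous.intervalIntegrable (by fun_prop) _ _)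
  have h1 := Complex.reCLM.intervalIntegral_comp_comm (μ := volume) (a := 0) (b := T)
    (f := fun x : ℝ => sinhKernel (x + β * Complex.I))
    (Continuous.intervalIntegrable (by fun_prop) _ _)
  simp only [Complex.reCLM_apply] at h0 h1
  simp only [Complex.zero_re, Complex.zero_im, Complex.ofReal_zero, zero_mul, add_zero, zero_add,
    Complex.add_re, Complex.sub_re, smul_eq_mul, Complex.I_mul_re, hl] at key
  rw [h0, h1]
  linarith

theorem integral_sq_sub_one_mul_exp (U : ℝ) :
    ∫ u in (0 : ℝ)..U, (u ^ 2 - 1) * Real.exp (-5 * u ^ 2)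
      = -(9 / 10) * (∫ u in (0 : ℝ)..U, Real.exp (-5 * u ^ 2))
        - 1 / 10 * (U * Real.exp (-5 * U ^ 2)) := by
  have hd : ∀ u ∈ Set.uIcc 0 U, HasDerivAt (fun u : ℝ => -(1 / 10) * (u * Real.exp (-5 * u ^ 2)))
      ((u ^ 2 - 1) * Real.exp (-5 * u ^ 2) + 9 / 10 * Real.exp (-5 * u ^ 2)) u := fun u _ => by
    have h1 : HasDerivAt (fun u : ℝ => -5 * u ^ 2) (-5 * (2 * u)) u := by
      simpa using (hasDerivAt_pow 2 u).const_mul (-5)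
    refine (((hasDerivAt_id u).fun_mul h1.exp).const_mul (-(1 / 10))).congr_deriv ?_
    simp only [id]
    ring
  have key := intervalIntegral.integral_eq_sub_of_hasDerivAt hd
    (Continuous.intervalIntegrable (by fun_prop) _ _)
  rw [intervalIntegral.integral_add (Continuous.intervalIntegrable (by fun_prop) _ _)
    (Continuous.intervalIntegrable (by fun_prop) _ _), intervalIntegral.integral_const_mul] at key
  linarith

theorem tendsto_integral_sq_sub_one_mul_exp :
    Filter.Tendsto (fun U : ℝ => ∫ u in (0 : ℝ)..U, (u ^ 2 - 1) * Real.exp (-5 * u ^ 2))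
      Filter.atTop (nhds (-(9 / 20) * √(π / 5))) := by
  simp_rw [integral_sq_sub_one_mul_exp]
  have h1 := intervalIntegral_tendsto_integral_Ioi 0
    (integrable_exp_neg_mul_sq (b := 5) (by norm_num)).integrableOn Filter.tendsto_id
  rw [integral_gaussian_Ioi] at h1
  simp only [id] at h1
  have h2 : Filter.Tendsto (fun U : ℝ => U * Real.exp (-5 * U ^ 2)) Filter.atTop (nhds 0) := by
    have h := (tendsto_rpow_abs_mul_exp_neg_mul_sq_cocompact (a := 5) (by norm_num) 1).mono_left
      atTop_le_cocompact
    refine h.congr' ?_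
    filter_upwards [Filter.eventually_ge_atTop 0] with U hU
    rw [Real.rpow_one, abs_of_nonneg hU]
  convert (h1.const_mul (-(9 / 10))).sub (h2.const_mul (1 / 10)) using 2
  ring

theorem tendsto_sinh_atTop : Filter.Tendsto Real.sinh Filter.atTop Filter.atTop :=
  Real.sinhOrderIso.tendsto_atTop

theorem integral_sinhKernel_re_of_cos_sin {β : ℝ} (hc : Real.cos β = 2 / √5)
    (hs : Real.sin β = 1 / √5) (T : ℝ) :
    ∫ x in (0 : ℝ)..T, (sinhKernel (x + β * Complex.I)).re
      = 2 / (5 * √5 * Real.exp 1)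
        * ∫ u in (0 : ℝ)..Real.sinh T, (u ^ 2 - 1) * Real.exp (-5 * u ^ 2) := by
  simp_rw [sinhKernel_re_of_cos_sin hc hs]
  rw [intervalIntegral.integral_const_mul]
  have key := intervalIntegral.integral_comp_mul_deriv (a := 0) (b := T)
    (fun x _ => Real.hasDerivAt_sinh x) (by fun_prop)
    (g := fun u => (u ^ 2 - 1) * Real.exp (-5 * u ^ 2)) (by fun_prop)
  rw [Real.sinh_zero] at key
  rw [← key]
  rfl

theorem tendsto_integral_sinhKernel_vertical {β : ℝ} (h0 : 0 ≤ β) (h1 : β ≤ π / 2)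
    (hc : 4 / 5 ≤ Real.cos β ^ 2) :
    Filter.Tendsto (fun T : ℝ => ∫ y in (0 : ℝ)..β, sinhKernel (T + y * Complex.I))
      Filter.atTop (nhds 0) := by
  have hv : Filter.Tendsto (fun T : ℝ => 1 + Real.sinh T ^ 2) Filter.atTop Filter.atTop :=
    Filter.tendsto_atTop_add_const_left _ _
      ((Filter.tendsto_pow_atTop two_ne_zero).comp tendsto_sinh_atTop)
  have hb := ((tendsto_pow_mul_exp_neg_atTop_nhds_zero 2).comp hv).const_mul (Real.exp 4 * |β - 0|)
  rw [mul_zero] at hb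
  refine squeeze_zero_norm (fun T => ?_) hb
  refine (intervalIntegral.norm_integral_le_of_norm_le_const
    (C := (1 + Real.sinh T ^ 2) ^ 2 * Real.exp (4 - (1 + Real.sinh T ^ 2)))
    fun y hy => ?_).trans_eq ?_
  · rw [Set.uIoc_of_le h0] at hy
    have hcb : 0 ≤ Real.cos β := Real.cos_nonneg_of_neg_pi_div_two_le_of_le (by linarith) h1
    have hle : Real.cos β ≤ Real.cos y :=
      Real.cos_le_cos_of_nonneg_of_le_pi hy.1.le (by linarith [Real.pi_pos]) hy.2
    exact norm_sinhKernel_le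
      (Real.sin_nonneg_of_nonneg_of_le_pi hy.1.le (by linarith [Real.pi_pos, hy.2]))
      (hcb.trans hle) (hc.trans (by gcongr))
  · simp only [Function.comp_apply]
    rw [sub_eq_add_neg 4, Real.exp_add]
    ring

theorem integrableOn_sqrt_mul_cos_mul_exp :
    IntegrableOn (fun x : ℝ =>
      Real.sqrt x * Real.cos (4 * Real.sqrt (x * (x + 1))) * Real.exp (-3 * x))
      (Set.Ioi 0) := by
  have h := integrableOn_rpow_mul_exp_neg_mul_rpow (s := 1 / 2) (p := 1) (b := 3)
    (by norm_num) (by norm_num) (by norm_num)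
  refine Integrable.mono' h (Continuous.aestronglyMeasurable (by fun_prop))
    (Filter.Eventually.of_forall fun x => ?_)
  rw [norm_mul, norm_mul, Real.norm_of_nonneg (Real.sqrt_nonneg x),
    Real.norm_of_nonneg (Real.exp_pos _).le, Real.rpow_one, Real.sqrt_eq_rpow]
  gcongr
  rw [← Real.sqrt_eq_rpow]
  exact mul_le_of_le_one_right (Real.sqrt_nonneg x) (Real.abs_cos_le_one _)

theorem stmt14 :
    ∫ x in Set.Ioi (0:ℝ),
        Real.sqrt x * Real.cos (4 * Real.sqrt (x * (x + 1))) * Real.exp (-3 * x)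
      = -(9 * Real.sqrt π) / (125 * Real.exp 1) := by
  have h5 : √5 ^ 2 = (5 : ℝ) := Real.sq_sqrt (by norm_num)
  obtain ⟨β, h0, h1, hc, hs⟩ : ∃ β : ℝ, 0 ≤ β ∧ β ≤ π / 2 ∧ Real.cos β = 2 / √5
      ∧ Real.sin β = 1 / √5 := by
    have hle : (1 : ℝ) / √5 ≤ 1 := by
      rw [div_le_one (by positivity), Real.one_le_sqrt]
      norm_num
    have hnn : (0 : ℝ) ≤ 1 / √5 := by positivity
    refine ⟨Real.arcsin (1 / √5), Real.arcsin_nonneg.2 hnn, Real.arcsin_le_pi_div_two _, ?_,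
      Real.sin_arcsin (by linarith) hle⟩
    rw [Real.cos_arcsin, Real.sqrt_eq_iff_mul_self_eq_of_pos (by positivity)]
    field_simp
    rw [h5]
    norm_num
  have hc' : 4 / 5 ≤ Real.cos β ^ 2 := by
    rw [hc, div_pow, h5]
    norm_num
  have hside := (Complex.continuous_im.tendsto _).comp
    (tendsto_integral_sinhKernel_vertical h0 h1 hc')
  have hmain := (tendsto_integral_sq_sub_one_mul_exp.comp tendsto_sinh_atTop).const_mul
    (2 / (5 * √5 * Real.exp 1))
  have hright := (hmain.add hside).const_mul 2
  have hleft := intervalIntegral_tendsto_integral_Ioi 0 integrableOn_sqrt_mul_cos_mul_exp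
    ((Filter.tendsto_pow_atTop two_ne_zero).comp tendsto_sinh_atTop)
  refine (tendsto_nhds_unique_of_eventuallyEq hleft hright ?_).trans ?_
  · filter_upwards [Filter.eventually_ge_atTop 0] with T hT
    have e1 := integral_sinhKernel_re hT
    have e2 := integral_sinhKernel_re_shift T β
    rw [integral_sinhKernel_re_of_cos_sin hc hs] at e2
    simp only [Function.comp_apply]
    linarith
  · rw [Complex.zero_im, Real.sqrt_div Real.pi_pos.le]
    field_simp
    rw [h5]
    ring
end
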